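/- arXiv:2110.04723 — 2 statements merged into one kernel-verified Lean document; each statement's English description precedes it below -/
import Mathlib

section
/- With the standing setup, for each 1 ≤ i ≤ m the permutation u_i belongs to the block [u,v]^{(i)}; that is, u_i has the same odd diagram D as u (so u ≤ u_i ≤ v) and u_i^{-1}(k) = a_i. -/
open Equiv Finset Polynomial

/-- The odd diagram of a permutation of `Fin n` (0-based positions and values):
boxes `(i, j)` with `w i > j`, `i < w⁻¹ j`, and `i`, `w⁻¹ j` of different parity. -/
def oddDiagram {n : ℕ} (w : Equiv.Perm (Fin n)) : Set (Fin n × Fin n) :=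
  {p | p.2 < w p.1 ∧ p.1 < w⁻¹ p.2 ∧ ((p.1 : ℕ) % 2 ≠ ((w⁻¹ p.2 : Fin n) : ℕ) % 2)}

/-- The Bruhat order on `S_n`: the reflexive-transitive closure of the relations
`x < x * (i j)` whenever `i < j` and `x i < x j`. -/
def bruhatLE {n : ℕ} : Equiv.Perm (Fin n) → Equiv.Perm (Fin n) → Prop :=
  Relation.ReflTransGen (fun x y => ∃ i j : Fin n, i < j ∧ x i < x j ∧ y = x * Equiv.swap i j)

/-- Strict Bruhat order. -/
def bruhatLT {n : ℕ} (x y : Equiv.Perm (Fin n)) : Prop := bruhatLE x y ∧ x ≠ y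

/-- The Coxeter length of a permutation, i.e. its number of inversions. -/
def invLength {n : ℕ} (w : Equiv.Perm (Fin n)) : ℕ :=
  (Finset.univ.filter (fun p : Fin n × Fin n => p.1 < p.2 ∧ w p.2 < w p.1)).card

theorem Equiv.Perm.inv_apply_apply_self {α : Type*} (f : Equiv.Perm α) (x : α) :
    f⁻¹ (f x) = x :=
  f.symm_apply_apply x

theorem Equiv.Perm.apply_inv_apply_self {α : Type*} (f : Equiv.Perm α) (x : α) :
    f (f⁻¹ x) = x :=
  f.apply_symm_apply x

/-- Swapping two positions `p < q` of equal parity with `w p < w q` preserves the odd diagram,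
provided the positions of the other parity avoid the two regions affected by the swap. -/
theorem oddDiagram_mul_swap {n : ℕ} (w : Equiv.Perm (Fin n)) {p q : Fin n} (hpq : p < q)
    (hpar : (p : ℕ) % 2 = (q : ℕ) % 2) (hlt : w p < w q)
    (hrow : ∀ l, p < l → w p < w l → w l < w q → (l : ℕ) % 2 = (p : ℕ) % 2)
    (hcol : ∀ l, p < l → l < q → w p < w l → (l : ℕ) % 2 = (p : ℕ) % 2) :
    oddDiagram (w * Equiv.swap p q) = oddDiagram w := by
  ext ⟨i, j⟩
  obtain ⟨l, rfl⟩ := w.surjective j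
  have hl := hrow l
  have hi := hcol i
  have hinv : (w * Equiv.swap p q)⁻¹ (w l) = Equiv.swap p q l := by
    simp [mul_inv_rev, Equiv.Perm.mul_apply]
  simp only [oddDiagram, Set.mem_ofPred_eq, hinv, Equiv.Perm.inv_apply_apply_self,
    Equiv.Perm.mul_apply, Equiv.swap_apply_def]
  have hinj : w l = w p → l = p := fun h => w.injective h
  clear hrow hcol hinv
  by_cases hip : i = p <;> by_cases hiq : i = q <;> by_cases hlp : l = p <;>
    by_cases hlq : l = q <;> simp only [hip, hiq, hlp, hlq, if_true, if_false, hpq.ne, hpq.ne'] <;>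
    grind

/-- If `u` and `v` have the same odd diagram and `k` is the least value they place differently,
then the positions in `[u⁻¹ k, v⁻¹ k)` at which `u` is at least `k` all have the parity
of `v⁻¹ k`. -/
theorem parity_eq_of_oddDiagram_eq {n : ℕ} {u v : Equiv.Perm (Fin n)}
    (huv : oddDiagram u = oddDiagram v) {k : Fin n}
    (hkmin : ∀ i : Fin n, i < k → u⁻¹ i = v⁻¹ i) {i : Fin n}
    (hai : u⁻¹ k ≤ i) (hib : i < v⁻¹ k) (hki : k ≤ u i) :
    (i : ℕ) % 2 = ((v⁻¹ k : Fin n) : ℕ) % 2 := by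
  by_contra hpar
  have hvi : k < v i := by
    by_contra hle
    rcases lt_or_eq_of_le (not_lt.mp hle) with hlt | heq
    · have h := hkmin _ hlt
      rw [Equiv.Perm.inv_apply_apply_self, Equiv.Perm.inv_eq_iff_eq] at h
      exact absurd hki (not_le.mpr (h ▸ hlt))
    · rw [← heq, Equiv.Perm.inv_apply_apply_self] at hib
      exact lt_irrefl _ hib
  have hmem : (i, k) ∈ oddDiagram u := huv ▸ (⟨hvi, hib, hpar⟩ : (i, k) ∈ oddDiagram v)
  exact absurd hmem.2.1 (not_lt.mpr hai)

/-- If `u` and `v` have the same odd diagram, the positions after `v⁻¹ k` at which `u` takes a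
value strictly between `k` and `u (v⁻¹ k)` all have the parity of `v⁻¹ k`. -/
theorem parity_eq_of_oddDiagram_eq_of_lt {n : ℕ} {u v : Equiv.Perm (Fin n)}
    (huv : oddDiagram u = oddDiagram v) {k l : Fin n}
    (hbl : v⁻¹ k < l) (hkl : k < u l) (hlb : u l < u (v⁻¹ k)) :
    (l : ℕ) % 2 = ((v⁻¹ k : Fin n) : ℕ) % 2 := by
  by_contra hpar
  have hu : (v⁻¹ k, u l) ∈ oddDiagram u :=
    ⟨hlb, by simpa using hbl, by simpa using Ne.symm hpar⟩
  rw [huv] at hu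
  have hlt := hu.1
  simp only [Equiv.Perm.apply_inv_apply_self] at hlt
  exact lt_asymm hkl hlt

/-- With the standing setup, each `uᵢ` belongs to the block `[u,v]⁽ⁱ⁾`: it has odd
diagram `D` (hence lies in `[u, v]`) and `uᵢ⁻¹ k = aᵢ`. -/
theorem ui_in_block {n : ℕ} (D : Set (Fin n × Fin n)) (u v : Equiv.Perm (Fin n))
    (hu : oddDiagram u = D) (hv : oddDiagram v = D) (hne : u ≠ v)
    (hint : ∀ w : Equiv.Perm (Fin n), oddDiagram w = D ↔ (bruhatLE u w ∧ bruhatLE w v))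
    (k : Fin n) (hk : u⁻¹ k ≠ v⁻¹ k) (hkmin : ∀ i : Fin n, i < k → u⁻¹ i = v⁻¹ i)
    (m : ℕ) (hm : 0 < m) (aseq : Fin m → Fin n) (hmono : StrictMono aseq)
    (hrange : ∀ i : Fin n, (∃ j : Fin m, aseq j = i) ↔
      (u⁻¹ k ≤ i ∧ i ≤ v⁻¹ k ∧ u (u⁻¹ k) ≤ u i ∧ u i ≤ u (v⁻¹ k)))
    (useq : Fin m → Equiv.Perm (Fin n))
    (huseq0 : useq ⟨0, hm⟩ = u)
    (huseqS : ∀ (i : ℕ) (h : i + 1 < m),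
      useq ⟨i + 1, h⟩ = useq ⟨i, Nat.lt_of_succ_lt h⟩ *
        Equiv.swap (aseq ⟨i, Nat.lt_of_succ_lt h⟩) (aseq ⟨i + 1, h⟩)) :
    ∀ j : Fin m, oddDiagram (useq j) = D ∧ bruhatLE u (useq j) ∧
      bruhatLE (useq j) v ∧ (useq j)⁻¹ k = aseq j := by
  have huv : oddDiagram u = oddDiagram v := hu.trans hv.symm
  obtain ⟨ha0, h0b, hua0, hu0b⟩ := (hrange _).mp ⟨⟨0, hm⟩, rfl⟩
  have hab : u⁻¹ k < v⁻¹ k := lt_of_le_of_ne (ha0.trans h0b) hk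
  have hmem : ∀ j, u⁻¹ k ≤ aseq j ∧ aseq j ≤ v⁻¹ k ∧ k ≤ u (aseq j) ∧
      u (aseq j) ≤ u (v⁻¹ k) := fun j => by
    simpa using (hrange _).mp ⟨j, rfl⟩
  have hpar : ∀ l, u⁻¹ k ≤ l → k ≤ u l → u l ≤ u (v⁻¹ k) →
      (l : ℕ) % 2 = ((v⁻¹ k : Fin n) : ℕ) % 2 := by
    intro l hal hkl hlb
    rcases lt_trichotomy l (v⁻¹ k) with h | h | h
    · exact parity_eq_of_oddDiagram_eq huv hkmin hal h hkl
    · rw [h]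
    · refine parity_eq_of_oddDiagram_eq_of_lt huv h (lt_of_le_of_ne hkl fun hk' => ?_)
        (lt_of_le_of_ne hlb fun hb => h.ne' (u.injective hb))
      rw [hk', Equiv.Perm.inv_apply_apply_self] at hab
      exact lt_asymm hab (hk' ▸ h)
  have key : ∀ (j : ℕ) (hj : j < m), oddDiagram (useq ⟨j, hj⟩) = D ∧
      useq ⟨j, hj⟩ (aseq ⟨j, hj⟩) = k ∧ ∀ l, aseq ⟨j, hj⟩ < l → useq ⟨j, hj⟩ l = u l := by
    intro j
    induction j with
    | zero =>
      intro hj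
      refine ⟨huseq0 ▸ hu, ?_, fun l _ => by rw [huseq0]⟩
      obtain ⟨j', hj'⟩ := (hrange (u⁻¹ k)).mpr ⟨le_rfl, hab.le, le_rfl, hua0.trans hu0b⟩
      have hle : aseq ⟨0, hm⟩ ≤ aseq j' := hmono.monotone (Nat.zero_le _)
      rw [huseq0, le_antisymm (hle.trans_eq hj') ha0, Equiv.Perm.apply_inv_apply_self]
    | succ j ih =>
      intro hj
      obtain ⟨hD, hval, htail⟩ := ih (Nat.lt_of_succ_lt hj)
      rw [huseqS j hj]
      have hpq : aseq ⟨j, Nat.lt_of_succ_lt hj⟩ < aseq ⟨j + 1, hj⟩ := hmono (Nat.lt_succ_self j)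
      generalize useq ⟨j, Nat.lt_of_succ_lt hj⟩ = w at *
      obtain ⟨hap, hpb, hkp, hup⟩ := hmem ⟨j, Nat.lt_of_succ_lt hj⟩
      obtain ⟨haq, hqb, hkq, huq⟩ := hmem ⟨j + 1, hj⟩
      generalize aseq ⟨j, Nat.lt_of_succ_lt hj⟩ = p at *
      generalize aseq ⟨j + 1, hj⟩ = q at *
      have hwq : k < w q := by
        rw [htail q hpq]
        refine lt_of_le_of_ne hkq fun h => ?_
        rw [h, Equiv.Perm.inv_apply_apply_self] at hap
        exact absurd hpq (not_lt.mpr hap)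
      have hpp := hpar p hap hkp hup
      refine ⟨?_, by simp [Equiv.Perm.mul_apply, hval], fun l hl => ?_⟩
      · rw [oddDiagram_mul_swap w hpq (hpp.trans (hpar q haq hkq huq).symm) (hval ▸ hwq), hD]
        · intro l hpl hkl hlq
          rw [hval, htail l hpl] at hkl
          rw [htail l hpl, htail q hpq] at hlq
          exact (hpar l (hap.trans hpl.le) hkl.le (hlq.le.trans huq)).trans hpp.symm
        · intro l hpl hlq hkl
          rw [hval, htail l hpl] at hkl
          exact (parity_eq_of_oddDiagram_eq huv hkmin (hap.trans hpl.le) (hlq.trans_le hqb)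
            hkl.le).trans hpp.symm
      · rw [Equiv.Perm.mul_apply, Equiv.swap_apply_of_ne_of_ne (hpq.trans hl).ne' hl.ne',
          htail l (hpq.trans hl)]
  intro j
  obtain ⟨hD, hval, -⟩ := key j j.isLt
  exact ⟨hD, ((hint _).mp hD).1, ((hint _).mp hD).2, Equiv.Perm.inv_eq_iff_eq.mpr hval.symm⟩
end

section
/- With the standing setup, all the blocks [u,v]^{(1)}, [u,v]^{(2)}, ..., [u,v]^{(m)} have the same cardinality; together with the fact that they partition [u,v], this gives a uniform partition of the odd diagram class [u,v] into m blocks. -/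
open Equiv Finset Polynomial

theorem perm_inv_apply_self {α : Type*} (w : Equiv.Perm α) (x : α) : w⁻¹ (w x) = x :=
  w.symm_apply_apply x

theorem perm_apply_inv_self {α : Type*} (w : Equiv.Perm α) (x : α) : w (w⁻¹ x) = x :=
  w.apply_symm_apply x

theorem perm_mul_swap_self {α : Type*} [DecidableEq α] (w : Equiv.Perm α) (x : α) :
    w * swap x x = w := by
  rw [Equiv.swap_self]
  exact mul_one w

/-- Membership in the odd diagram, with the column indexed by the position of its value. -/
theorem mem_oddDiagram_apply {n : ℕ} (w : Equiv.Perm (Fin n)) (i q : Fin n) :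
    (i, w q) ∈ oddDiagram w ↔ w q < w i ∧ i < q ∧ (i : ℕ) % 2 ≠ (q : ℕ) % 2 := by
  simp [oddDiagram]

/-- Swapping two positions `p < p'` of equal parity with `w p < w p'` preserves the odd diagram if
every opposite-parity entry to the upper right of `p` is also to the upper right of `p'`. -/
theorem oddDiagram_mul_swap_of_lt {n : ℕ} (w : Equiv.Perm (Fin n)) {p p' : Fin n} (hlt : p < p')
    (hpar : (p : ℕ) % 2 = (p' : ℕ) % 2) (hw : w p < w p')
    (H : ∀ q : Fin n, (q : ℕ) % 2 ≠ (p : ℕ) % 2 → p < q → w p < w q → p' < q ∧ w p' < w q) :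
    oddDiagram (w * swap p p') = oddDiagram w := by
  ext ⟨i, j⟩
  obtain ⟨r, rfl⟩ := w.surjective j
  rw [mem_oddDiagram_apply]
  simp only [oddDiagram, Set.mem_ofPred_eq, mul_inv_rev, Equiv.swap_inv, Equiv.Perm.mul_apply,
    perm_inv_apply_self]
  have hi := H i
  have hr := H r
  by_cases hrp : r = p
  · subst hrp
    by_cases hip : i = r
    · subst hip; simp; omega
    by_cases hip' : i = p'
    · subst hip'; simp
      omega
    simp only [Equiv.swap_apply_left, Equiv.swap_apply_of_ne_of_ne hip hip']
    omega
  by_cases hrp' : r = p'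
  · subst hrp'
    by_cases hip : i = p
    · subst hip; simp; omega
    by_cases hip' : i = r
    · subst hip'; simp
      omega
    simp only [Equiv.swap_apply_right, Equiv.swap_apply_of_ne_of_ne hip hip']
    omega
  have hrw : w r ≠ w p := fun h => hrp (w.injective h)
  simp only [Equiv.swap_apply_of_ne_of_ne hrp hrp']
  by_cases hip : i = p
  · subst hip; simp; omega
  by_cases hip' : i = p'
  · subst hip'; simp
    omega
  simp only [Equiv.swap_apply_of_ne_of_ne hip hip']

/-- If `w` and `w'` have the same odd diagram and the same positions of the values below `k`, then
the positions of `k` have equal parity, and every opposite-parity entry of `w` exceeding `k` to the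
right of one of these positions is to the upper right of both. -/
theorem parity_and_upper_right_of_oddDiagram_eq {n : ℕ} {w w' : Equiv.Perm (Fin n)}
    (hD : oddDiagram w = oddDiagram w') {k : Fin n} (hpre : ∀ i < k, w⁻¹ i = w'⁻¹ i)
    {p p' : Fin n} (hp : w p = k) (hp' : w' p' = k) (hne : p ≠ p') :
    (p : ℕ) % 2 = (p' : ℕ) % 2 ∧ k < w p' ∧
      ∀ q : Fin n, (q : ℕ) % 2 ≠ (p : ℕ) % 2 → (p < q ∨ p' < q) → k < w q →
        p < q ∧ p' < q ∧ w p' < w q := by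
  have hfree : ∀ q, w q ≠ k → w' q ≠ k → (k < w q ↔ k < w' q) := by
    intro q h1 h2
    constructor
    · intro h
      by_contra h3
      have h4 := hpre (w' q) (by omega)
      rw [perm_inv_apply_self, Equiv.Perm.inv_eq_iff_eq] at h4
      omega
    · intro h
      by_contra h3
      have h4 := hpre (w q) (by omega)
      rw [perm_inv_apply_self, eq_comm, Equiv.Perm.inv_eq_iff_eq] at h4
      omega
  have hwp' : k < w p' := by
    have h1 : w p' ≠ k := fun h => hne (w.injective (hp.trans h.symm))
    by_contra h3
    have h4 := hpre (w p') (by omega)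
    rw [perm_inv_apply_self, eq_comm, Equiv.Perm.inv_eq_iff_eq] at h4
    omega
  have hw'p : k < w' p := by
    have h1 : w' p ≠ k := fun h => hne (w'.injective (h.trans hp'.symm))
    by_contra h3
    have h4 := hpre (w' p) (by omega)
    rw [perm_inv_apply_self, Equiv.Perm.inv_eq_iff_eq] at h4
    omega
  have hcol : ∀ i, (k < w i ∧ i < p ∧ (i : ℕ) % 2 ≠ (p : ℕ) % 2) ↔
      (k < w' i ∧ i < p' ∧ (i : ℕ) % 2 ≠ (p' : ℕ) % 2) := by
    intro i
    have h1 := mem_oddDiagram_apply w i p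
    have h2 := mem_oddDiagram_apply w' i p'
    rw [hp] at h1
    rw [hp', ← hD] at h2
    exact h1.symm.trans h2
  have hpar : (p : ℕ) % 2 = (p' : ℕ) % 2 := by
    have h1 := hcol p
    have h2 := hcol p'
    omega
  refine ⟨hpar, hwp', fun q hq hor hkq => ?_⟩
  have hqp : q ≠ p := by rintro rfl; exact hq rfl
  have hqp' : q ≠ p' := by rintro rfl; exact hq hpar.symm
  have hkq' : k < w' q := (hfree q (fun h => hqp (w.injective (h.trans hp.symm)))
    (fun h => hqp' (w'.injective (h.trans hp'.symm)))).1 hkq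
  have h1 := hcol q
  have hboth : p < q ∧ p' < q := by omega
  refine ⟨hboth.1, hboth.2, ?_⟩
  by_contra hlt
  have hne' : w q ≠ w p' := fun h => hqp' (w.injective h)
  have hmem : (p', w q) ∈ oddDiagram w := by
    rw [mem_oddDiagram_apply]
    omega
  rw [hD] at hmem
  have h2 : w q < w' p' := hmem.1
  omega

/-- If `w` and `w'` have the same odd diagram and the same positions of the values below `k`, then
moving `k` in `w` to its position in `w'` by a swap preserves the odd diagram. -/
theorem oddDiagram_mul_swap_of_oddDiagram_eq {n : ℕ} {w w' : Equiv.Perm (Fin n)}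
    (hD : oddDiagram w = oddDiagram w') {k : Fin n} (hpre : ∀ i < k, w⁻¹ i = w'⁻¹ i)
    {p p' : Fin n} (hp : w p = k) (hp' : w' p' = k) :
    oddDiagram (w * swap p p') = oddDiagram w := by
  rcases eq_or_ne p p' with rfl | hne
  · rw [perm_mul_swap_self]
  obtain ⟨hpar, hwp', H⟩ := parity_and_upper_right_of_oddDiagram_eq hD hpre hp hp' hne
  rcases lt_or_gt_of_ne hne with hlt | hlt
  · refine oddDiagram_mul_swap_of_lt w hlt hpar (hp ▸ hwp') fun q hq hpq hwq => ?_
    exact (H q hq (Or.inl hpq) (hp ▸ hwq)).2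
  · have h := oddDiagram_mul_swap_of_lt (w * swap p p') hlt hpar.symm (by simpa [hp] using hwp') ?_
    · rw [← h, Equiv.swap_comm p' p, mul_assoc, Equiv.swap_mul_self, mul_one]
    intro q hq hpq hwq
    have hqp : q ≠ p := by rintro rfl; exact hq hpar
    have hqp' : q ≠ p' := by rintro rfl; exact hq rfl
    rw [Equiv.Perm.mul_apply, Equiv.Perm.mul_apply, Equiv.swap_apply_right,
      Equiv.swap_apply_of_ne_of_ne hqp hqp', hp] at hwq
    rw [Equiv.Perm.mul_apply, Equiv.Perm.mul_apply, Equiv.swap_apply_left,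
      Equiv.swap_apply_of_ne_of_ne hqp hqp']
    have := H q (hpar ▸ hq) (Or.inr hpq) hwq
    exact ⟨this.1, this.2.2⟩

/-- The one-line notation of the inverse is lexicographically monotone in the Bruhat order. -/
theorem toLex_inv_le_of_bruhatLE {n : ℕ} {x y : Equiv.Perm (Fin n)} (h : bruhatLE x y) :
    toLex (fun i => x⁻¹ i) ≤ toLex (fun i => y⁻¹ i) := by
  induction h with
  | refl => exact le_rfl
  | @tail z y _ hzy ih =>
    obtain ⟨i, j, hij, hz, rfl⟩ := hzy
    refine ih.trans (le_of_lt ⟨z i, fun l hl => ?_, ?_⟩)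
    · have h1 : z⁻¹ l ≠ i := fun h => by
        rw [Equiv.Perm.inv_eq_iff_eq] at h; omega
      have h2 : z⁻¹ l ≠ j := fun h => by
        rw [Equiv.Perm.inv_eq_iff_eq] at h; omega
      simp only [mul_inv_rev, Equiv.swap_inv, Equiv.Perm.mul_apply]
      exact (Equiv.swap_apply_of_ne_of_ne h1 h2).symm
    · simpa using hij

/-- A sequence lexicographically above `f` that agrees with `f` below `k` is at least `f` at `k`. -/
theorem le_apply_of_toLex_le {n : ℕ} {α : Type*} [LinearOrder α] {f g : Fin n → α}
    (h : toLex f ≤ toLex g) (k : Fin n) (hk : ∀ i < k, f i = g i) : f k ≤ g k := by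
  by_contra! hlt
  exact absurd h (not_le_of_gt (show toLex g < toLex f from ⟨k, fun i hi => (hk i hi).symm, hlt⟩))

/-- A sequence lexicographically between two sequences agreeing below `k` agrees with them there. -/
theorem eq_of_toLex_le_of_toLex_le {n : ℕ} {α : Type*} [LinearOrder α] {f g h : Fin n → α}
    (hfg : toLex f ≤ toLex g) (hgh : toLex g ≤ toLex h) (k : Fin n) (hk : ∀ i < k, f i = h i)
    (i : Fin n) (hi : i < k) : f i = g i := by
  induction i using WellFoundedLT.induction with
  | ind i ih =>
    refine le_antisymm (le_apply_of_toLex_le hfg i fun l hl => ih l hl (hl.trans hi)) ?_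
    rw [hk i hi]
    exact le_apply_of_toLex_le hgh i fun l hl => by
      rw [← ih l hl (hl.trans hi), hk l (hl.trans hi)]

open Classical in
/-- With the standing setup, the blocks `[u,v]⁽ⁱ⁾` partition the interval `[u, v]`
and all have the same cardinality: a uniform partition of the odd diagram class. -/
theorem uniform_partition {n : ℕ} (D : Set (Fin n × Fin n)) (u v : Equiv.Perm (Fin n))
    (hu : oddDiagram u = D) (hv : oddDiagram v = D) (hne : u ≠ v)
    (hint : ∀ w : Equiv.Perm (Fin n), oddDiagram w = D ↔ (bruhatLE u w ∧ bruhatLE w v))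
    (k : Fin n) (hk : u⁻¹ k ≠ v⁻¹ k) (hkmin : ∀ i : Fin n, i < k → u⁻¹ i = v⁻¹ i)
    (m : ℕ) (hm : 0 < m) (aseq : Fin m → Fin n) (hmono : StrictMono aseq)
    (hrange : ∀ i : Fin n, (∃ j : Fin m, aseq j = i) ↔
      (u⁻¹ k ≤ i ∧ i ≤ v⁻¹ k ∧ u (u⁻¹ k) ≤ u i ∧ u i ≤ u (v⁻¹ k))) :
    (∀ w : Equiv.Perm (Fin n), bruhatLE u w → bruhatLE w v →
      ∃! j : Fin m, w⁻¹ k = aseq j) ∧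
    ∀ j j' : Fin m,
      (Finset.univ.filter (fun w : Equiv.Perm (Fin n) =>
        bruhatLE u w ∧ bruhatLE w v ∧ w⁻¹ k = aseq j)).card =
      (Finset.univ.filter (fun w : Equiv.Perm (Fin n) =>
        bruhatLE u w ∧ bruhatLE w v ∧ w⁻¹ k = aseq j')).card := by
  have hprefix : ∀ w, oddDiagram w = D → ∀ i < k, u⁻¹ i = w⁻¹ i := fun w hw =>
    eq_of_toLex_le_of_toLex_le (toLex_inv_le_of_bruhatLE ((hint w).1 hw).1)
      (toLex_inv_le_of_bruhatLE ((hint w).1 hw).2) k hkmin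
  have hswap : ∀ w w' : Equiv.Perm (Fin n), oddDiagram w = D → oddDiagram w' = D →
      oddDiagram (w * swap (w⁻¹ k) (w'⁻¹ k)) = D := fun w w' hw hw' => by
    rw [oddDiagram_mul_swap_of_oddDiagram_eq (hw.trans hw'.symm)
      (fun i hi => (hprefix w hw i hi).symm.trans (hprefix w' hw' i hi))
      (perm_apply_inv_self w k) (perm_apply_inv_self w' k), hw]
  obtain ⟨a, ha⟩ : ∃ a, u⁻¹ k = a := ⟨_, rfl⟩
  obtain ⟨b, hb⟩ : ∃ b, v⁻¹ k = b := ⟨_, rfl⟩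
  have hua : u a = k := by rw [← ha, perm_apply_inv_self]
  have hvb : v b = k := by rw [← hb, perm_apply_inv_self]
  rw [ha, hb] at hk
  simp only [ha, hb, hua] at hrange
  have hbounds : ∀ w, oddDiagram w = D → a ≤ w⁻¹ k ∧ w⁻¹ k ≤ b := fun w hw => by
    have hw' := (hint w).1 hw
    rw [← ha, ← hb]
    exact ⟨le_apply_of_toLex_le (toLex_inv_le_of_bruhatLE hw'.1) k (hprefix w hw),
      le_apply_of_toLex_le (toLex_inv_le_of_bruhatLE hw'.2) k
        fun i hi => (hprefix w hw i hi).symm.trans (hkmin i hi)⟩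
  obtain ⟨hparb, hub, Hb⟩ := parity_and_upper_right_of_oddDiagram_eq (hu.trans hv.symm)
    hkmin hua hvb hk
  have hpos : ∀ w, oddDiagram w = D → ∃ j, aseq j = w⁻¹ k := fun w hw => by
    rw [hrange]
    obtain ⟨h1, h2⟩ := hbounds w hw
    obtain ⟨p, hp⟩ : ∃ p, w⁻¹ k = p := ⟨_, rfl⟩
    have hwp : w p = k := by rw [← hp, perm_apply_inv_self]
    rw [hp] at h1 h2 ⊢
    rcases eq_or_ne a p with rfl | hap
    · exact ⟨h1, h2, hua.ge, hua.trans_le hub.le⟩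
    obtain ⟨hparp, hup, Hp⟩ := parity_and_upper_right_of_oddDiagram_eq (hu.trans hw.symm)
      (hprefix w hw) hua hwp hap
    refine ⟨h1, h2, hup.le, ?_⟩
    by_contra! hlt
    have hpb : p < b := lt_of_le_of_ne h2 (by rintro rfl; exact lt_irrefl _ hlt)
    have hD : oddDiagram (u * swap p b) = D := by
      have h := oddDiagram_mul_swap_of_lt (u * swap p b) hpb (hparp.symm.trans hparb)
        (by simpa using hlt) ?_
      · rw [← hu, ← h, mul_assoc, Equiv.swap_mul_self, mul_one]
      intro q hq hpq huq
      have hqp : q ≠ p := by rintro rfl; exact hq rfl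
      have hqb : q ≠ b := by rintro rfl; exact hq (hparb.symm.trans hparp)
      rw [Equiv.Perm.mul_apply, Equiv.Perm.mul_apply, Equiv.swap_apply_left,
        Equiv.swap_apply_of_ne_of_ne hqp hqb] at huq
      rw [Equiv.Perm.mul_apply, Equiv.Perm.mul_apply, Equiv.swap_apply_right,
        Equiv.swap_apply_of_ne_of_ne hqp hqb]
      have haq : a < q := h1.trans_lt hpq
      have hkq : k < u q := hub.trans huq
      have hqa : (q : ℕ) % 2 ≠ (a : ℕ) % 2 := hparp ▸ hq
      exact ⟨(Hb q hqa (Or.inl haq) hkq).2.1, (Hp q hqa (Or.inl haq) hkq).2.2⟩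
    have hle : bruhatLE (u * swap p b) u :=
      Relation.ReflTransGen.single ⟨p, b, hpb, by simpa using hlt, by
        rw [mul_assoc, Equiv.swap_mul_self, mul_one]⟩
    have heq := le_antisymm (toLex_inv_le_of_bruhatLE hle)
      (toLex_inv_le_of_bruhatLE ((hint _).1 hD).1)
    have h3 := congrFun (toLex_inj.1 heq) (u p)
    simp only [mul_inv_rev, Equiv.swap_inv, Equiv.Perm.mul_apply, perm_inv_apply_self,
      Equiv.swap_apply_left] at h3
    exact hpb.ne' h3
  have hex : ∀ j, ∃ w, oddDiagram w = D ∧ w⁻¹ k = aseq j := fun j => by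
    obtain ⟨h1, h2, h3, h4⟩ := (hrange (aseq j)).1 ⟨j, rfl⟩
    obtain ⟨p, hp⟩ : ∃ p, aseq j = p := ⟨_, rfl⟩
    rw [hp] at h1 h2 h3 h4 ⊢
    refine ⟨u * swap a p, ?_, by
      rw [mul_inv_rev, Equiv.swap_inv, Equiv.Perm.mul_apply, ha, Equiv.swap_apply_left]⟩
    rcases eq_or_ne a p with rfl | hap
    · rwa [perm_mul_swap_self]
    have hlt : a < p := lt_of_le_of_ne h1 hap
    have hup : k < u p := lt_of_le_of_ne h3 (fun h => hap (u.injective (hua.trans h)))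
    rw [oddDiagram_mul_swap_of_lt u hlt ?_ (hua.trans_lt hup) ?_, hu]
    · by_contra hpar
      exact h2.not_gt (Hb p (Ne.symm hpar) (Or.inl hlt) hup).2.1
    · intro q hq haq huq
      obtain ⟨-, h5, h6⟩ := Hb q hq (Or.inl haq) (hua ▸ huq)
      exact ⟨h2.trans_lt h5, h4.trans_lt h6⟩
  have hcard : ∀ j j' : Fin m,
      (Finset.univ.filter (fun w : Equiv.Perm (Fin n) =>
        bruhatLE u w ∧ bruhatLE w v ∧ w⁻¹ k = aseq j)).card ≤
      (Finset.univ.filter (fun w : Equiv.Perm (Fin n) =>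
        bruhatLE u w ∧ bruhatLE w v ∧ w⁻¹ k = aseq j')).card := fun j j' => by
    obtain ⟨w', hw', hk'⟩ := hex j'
    refine Finset.card_le_card_of_injOn (fun w => w * swap (aseq j) (aseq j')) ?_
      (fun x _ y _ hxy => mul_right_cancel hxy)
    intro w hw
    simp only [Finset.coe_filter, Finset.mem_univ, true_and, Set.mem_ofPred_eq] at hw ⊢
    have hD := hswap w w' ((hint w).2 ⟨hw.1, hw.2.1⟩) hw'
    rw [hw.2.2, hk'] at hD
    have hI := (hint _).1 hD
    exact ⟨hI.1, hI.2, by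
      rw [mul_inv_rev, Equiv.swap_inv, Equiv.Perm.mul_apply, hw.2.2, Equiv.swap_apply_left]⟩
  refine ⟨fun w huw hwv => ?_, fun j j' => le_antisymm (hcard j j') (hcard j' j)⟩
  obtain ⟨j, hj⟩ := hpos w ((hint w).2 ⟨huw, hwv⟩)
  exact ⟨j, hj.symm, fun l hl => hmono.injective (hl.symm.trans hj.symm)⟩
end
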